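/- Let Γ be the paradigm of exchangeable probability measures on Ω = {0,1}^ℕ. There exists a prequential test T : ([0,1] × {0,1})^ℕ → {FAIL, PASS} such that (i) T accepts the data-generating process in Γ with probability 1, i.e., μ(A_μ^T) = 1 for every μ ∈ Γ, and (ii) T is strongly non-manipulable with respect to Γ, i.e., for every Borel probability measure ζ on Γ, the set of μ ∈ Γ for which (ζ ⊗ μ)({(ν, x) : x ∈ A_ν^T}) = 0 is co-meager in Γ. -/

import Mathlib

open MeasureTheory Filter

/-- The realization space Ω = {0,1}^ℕ. -/
abbrev Omega : Type := ℕ → Bool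

/-- The cylinder set N(σ) of realizations extending the partial realization σ. -/
def cyl (σ : List Bool) : Set Omega := {x | ∀ i : Fin σ.length, x i.1 = σ.get i}

/-- The partial realization (s₀, …, s_{n-1}) consisting of the first n outcomes of x. -/
def pref (x : Omega) (n : ℕ) : List Bool := List.ofFn (fun i : Fin n => x i.1)

/-- The forecast of μ after history σ: the conditional probability of outcome 1. -/
noncomputable def forecastOne (μ : Measure Omega) (σ : List Bool) : ℝ :=
  (μ (cyl (σ ++ [true]))).toReal / (μ (cyl σ)).toReal

/-- μ is exchangeable: cylinder probabilities are invariant under permutations. -/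
def Exchangeable (μ : Measure Omega) : Prop :=
  ∀ (σ : List Bool) (π : Equiv.Perm (Fin σ.length)),
    μ (cyl σ) = μ (cyl (List.ofFn (fun i => σ.get (π i))))

/-- The acceptance set A_μ^T : realizations over which μ passes the prequential test T.
The test receives the interleaved sequence ((p₀,s₀),(p₁,s₁),…) of forecasts and outcomes. -/
def acceptSet (T : (ℕ → ℝ × Bool) → Bool) (μ : Measure Omega) : Set Omega :=
  {x | (∀ n : ℕ, 0 < μ (cyl (pref x n))) ∧
    T (fun n => (forecastOne μ (pref x n), x n)) = true}

noncomputable instance : MeasurableSpace (ProbabilityMeasure Omega) := borel _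


open scoped Topology ENNReal

namespace ExchangeableTest

/-! ### Cylinders and exchangeability -/

/-- The realizations whose first `n` outcomes are given by `s`. -/
def finCyl {n : ℕ} (s : Fin n → Bool) : Set Omega := {x | ∀ i : Fin n, x i = s i}

/-- The first `n` outcomes of a realization. -/
def initSeg (n : ℕ) (x : Omega) : Fin n → Bool := fun i => x i

lemma cyl_eq_finCyl (σ : List Bool) : cyl σ = finCyl σ.get := rfl

lemma cyl_ofFn {n : ℕ} (s : Fin n → Bool) : cyl (List.ofFn s) = finCyl s := by
  ext x
  simp only [cyl, finCyl, Set.mem_ofPred_eq]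
  constructor
  · intro h i
    simpa using h ⟨i, by simp⟩
  · intro h i
    simpa using h ⟨i, by simpa using i.2⟩

lemma cyl_pref (x : Omega) (n : ℕ) : cyl (pref x n) = finCyl (initSeg n x) := cyl_ofFn _

lemma mem_finCyl {n : ℕ} {s : Fin n → Bool} {x : Omega} : x ∈ finCyl s ↔ initSeg n x = s :=
  funext_iff.symm

lemma measurable_initSeg (n : ℕ) : Measurable (initSeg n) :=
  measurable_pi_lambda _ fun i => measurable_pi_apply (i : ℕ)

lemma finCyl_eq_preimage {n : ℕ} (s : Fin n → Bool) : finCyl s = initSeg n ⁻¹' {s} := by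
  ext x; exact mem_finCyl

lemma measurableSet_finCyl {n : ℕ} (s : Fin n → Bool) : MeasurableSet (finCyl s) := by
  rw [finCyl_eq_preimage]
  exact measurable_initSeg n (measurableSet_singleton s)

lemma finCyl_initSeg (x : Omega) (n : ℕ) : finCyl (initSeg n x) = PiNat.cylinder x n := by
  ext y
  simp only [PiNat.cylinder, finCyl, initSeg, Set.mem_ofPred_eq]
  exact ⟨fun h i hi => h ⟨i, hi⟩, fun h i => h i i.2⟩

/-- The family of cylinder sets. -/
def cylinders : Set (Set Omega) := {C | ∃ (x : Omega) (n : ℕ), C = PiNat.cylinder x n}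

lemma isPiSystem_cylinders : IsPiSystem cylinders := by
  rintro _ ⟨x, n, rfl⟩ _ ⟨y, m, rfl⟩ ⟨z, hx, hy⟩
  rw [← PiNat.mem_cylinder_iff_eq.1 hx, ← PiNat.mem_cylinder_iff_eq.1 hy]
  rcases le_total n m with h | h
  · exact ⟨z, m, Set.inter_eq_right.2 (PiNat.cylinder_anti z h)⟩
  · exact ⟨z, n, Set.inter_eq_left.2 (PiNat.cylinder_anti z h)⟩

lemma isTopologicalBasis_cylinders : TopologicalSpace.IsTopologicalBasis cylinders :=
  PiNat.isTopologicalBasis_cylinders _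

lemma measurableSpace_eq_generateFrom_cylinders :
    (inferInstance : MeasurableSpace Omega) = MeasurableSpace.generateFrom cylinders := by
  rw [← isTopologicalBasis_cylinders.borel_eq_generateFrom]
  exact BorelSpace.measurable_eq

/-- Weak convergence of probability measures on `Omega` can be checked on cylinders. -/
lemma tendsto_of_tendsto_finCyl {ι : Type*} {l : Filter ι} [l.IsCountablyGenerated]
    {μ : ι → ProbabilityMeasure Omega} {ν : ProbabilityMeasure Omega}
    (h : ∀ (n : ℕ) (s : Fin n → Bool),
      Tendsto (fun i => (μ i : Measure Omega).real (finCyl s)) l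
        (𝓝 ((ν : Measure Omega).real (finCyl s)))) :
    Tendsto μ l (𝓝 ν) := by
  refine isPiSystem_cylinders.tendsto_probabilityMeasure_of_tendsto_of_mem ?_ ?_ ?_
  · exact fun s hs => (isTopologicalBasis_cylinders.isOpen hs).measurableSet
  · intro u hu x hx
    obtain ⟨s, hs, hxs, hsu⟩ := isTopologicalBasis_cylinders.exists_subset_of_mem_open hx hu
    exact ⟨s, hs, (isTopologicalBasis_cylinders.isOpen hs).mem_nhds hxs, hsu⟩
  · rintro _ ⟨x, n, rfl⟩
    rw [← finCyl_initSeg, ← NNReal.tendsto_coe]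
    exact h n _

/-- The measure of an event about the first `n` outcomes is a sum over cylinders. -/
lemma real_initSeg_preimage (μ : Measure Omega) [IsFiniteMeasure μ] (n : ℕ)
    (p : (Fin n → Bool) → Prop) [DecidablePred p] :
    μ.real {x | p (initSeg n x)} = ∑ s, if p s then μ.real (finCyl s) else 0 := by
  rw [← Finset.sum_filter]
  rw [← measureReal_biUnion_finset]
  · congr 1
    ext x
    simp [mem_finCyl]
  · intro s _ t _ hst
    refine Set.disjoint_left.2 fun x hs ht => hst ?_
    rw [← mem_finCyl.1 hs, mem_finCyl.1 ht]
  · exact fun s _ => measurableSet_finCyl s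

lemma sum_real_finCyl (μ : Measure Omega) [IsProbabilityMeasure μ] (n : ℕ) :
    ∑ s : Fin n → Bool, μ.real (finCyl s) = 1 := by
  have := real_initSeg_preimage μ n (fun _ => True)
  simpa using this.symm

lemma real_finCyl_comp_perm {μ : Measure Omega} (hμ : Exchangeable μ) {n : ℕ}
    (s : Fin n → Bool) (π : Equiv.Perm (Fin n)) :
    μ.real (finCyl (s ∘ π)) = μ.real (finCyl s) := by
  have key : ∀ (σ : List Bool) (hn : σ.length = n) (hs : ∀ i : Fin n, σ.get (i.cast hn.symm) = s i),
      μ (finCyl s) = μ (finCyl (s ∘ π)) := by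
    rintro σ rfl hs
    have hs : σ.get = s := funext hs
    have := hμ σ π
    rw [cyl_ofFn, cyl_eq_finCyl, hs] at this
    exact this
  rw [measureReal_def, measureReal_def, key (List.ofFn s) (by simp) (by simp)]

/-- An exchangeable measure gives the same mass to words with the same number of ones. -/
lemma real_finCyl_eq_of_card {μ : Measure Omega} (hμ : Exchangeable μ) {n : ℕ}
    {s t : Fin n → Bool}
    (h : Fintype.card {i // s i = true} = Fintype.card {i // t i = true}) :
    μ.real (finCyl s) = μ.real (finCyl t) := by
  let e : {i // s i = true} ≃ {i // t i = true} := Fintype.equivOfCardEq h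
  rw [← real_finCyl_comp_perm hμ t e.extendSubtype]
  congr 2
  funext i
  by_cases hi : s i = true
  · rw [Function.comp_apply, hi]
    exact (e.extendSubtype_mem i hi).symm
  · have := e.extendSubtype_not_mem i hi
    simp only [Bool.not_eq_true] at hi this
    rw [Function.comp_apply, hi]
    exact this.symm

/-- The joint law of finitely many distinct outcomes under an exchangeable measure. -/
lemma real_injective_marginal {μ : Measure Omega} [IsFiniteMeasure μ] (hμ : Exchangeable μ) {n : ℕ}
    {g : Fin n → ℕ} (hg : Function.Injective g) (s : Fin n → Bool) :
    μ.real {x | ∀ j, x (g j) = s j} = μ.real (finCyl s) := by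
  classical
  let M : ℕ := n + ∑ j, (g j + 1)
  have hnM : n ≤ M := Nat.le_add_right _ _
  have hgM : ∀ j, g j < M := fun j => by
    have := Finset.single_le_sum (f := fun j => g j + 1) (fun _ _ => Nat.zero_le _)
      (Finset.mem_univ j)
    simp only [M]
    omega
  let g' : Fin n → Fin M := fun j => ⟨g j, hgM j⟩
  have hg' : Function.Injective g' := fun a b h => hg (congrArg Fin.val h)
  let e : {i // i ∈ Set.range (Fin.castLE hnM)} ≃ {i // i ∈ Set.range g'} :=
    (Equiv.ofInjective _ (Fin.castLE_injective hnM)).symm.trans (Equiv.ofInjective _ hg')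
  let π : Equiv.Perm (Fin M) := e.extendSubtype
  have hπ : ∀ j, π (Fin.castLE hnM j) = g' j := fun j => by
    simp only [π]
    rw [e.extendSubtype_apply_of_mem _ ⟨j, rfl⟩]
    have : (Equiv.ofInjective _ (Fin.castLE_injective hnM)).symm ⟨Fin.castLE hnM j, j, rfl⟩ = j :=
      Equiv.ofInjective_symm_apply (Fin.castLE_injective hnM) j
    simp only [e, Equiv.trans_apply, this, Equiv.ofInjective_apply]
  have h1 := real_initSeg_preimage μ M (fun t => ∀ j, t (g' j) = s j)
  have h2 := real_initSeg_preimage μ M (fun t => ∀ j, t (Fin.castLE hnM j) = s j)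
  refine (h2.trans (Eq.trans ?_ h1.symm)).symm
  rw [← Equiv.sum_comp (Equiv.arrowCongr π.symm (Equiv.refl Bool))]
  refine Finset.sum_congr rfl fun t _ => ?_
  have : (Equiv.arrowCongr π.symm (Equiv.refl Bool)) t = t ∘ π := by ext i; simp [Equiv.arrowCongr]
  rw [this, real_finCyl_comp_perm hμ]
  simp [hπ]

/-! ### Reading a theory off its forecasts -/

/-- The number of ones in a finite word. -/
def ones {n : ℕ} (s : Fin n → Bool) : ℕ := ∑ i, if s i = true then 1 else 0

/-- The word of length `n` starting with ones up to position `k` and continuing with zeros. -/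
def word (n k : ℕ) : Fin n → Bool := fun i => decide ((i : ℕ) < k)

/-- The word `s` followed by `b`. -/
def snoc {n : ℕ} (s : Fin n → Bool) (b : Bool) : Fin (n + 1) → Bool :=
  Fin.snoc (α := fun _ => Bool) s b

@[simp] lemma snoc_castSucc {n : ℕ} (s : Fin n → Bool) (b : Bool) (i : Fin n) :
    snoc s b i.castSucc = s i := by simp [snoc]

@[simp] lemma snoc_last {n : ℕ} (s : Fin n → Bool) (b : Bool) : snoc s b (Fin.last n) = b := by
  simp [snoc]

lemma ones_snoc {n : ℕ} (s : Fin n → Bool) (b : Bool) :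
    ones (snoc s b) = ones s + if b = true then 1 else 0 := by
  rw [ones, Fin.sum_univ_castSucc]
  simp [ones]

lemma ones_word (n k : ℕ) : ones (word n k) = min n k := by
  induction n with
  | zero => simp [ones]
  | succ n ih =>
    have : word (n + 1) k = snoc (word n k) (decide (n < k)) := by
      funext i
      refine Fin.lastCases ?_ (fun i => ?_) i <;> simp [word]
    rw [this, ones_snoc, ih]
    by_cases h : n < k <;> simp only [h, decide_true, decide_false, if_true, if_false,
      Bool.false_eq_true] <;> omega

lemma ones_le {n : ℕ} (s : Fin n → Bool) : ones s ≤ n :=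
  (Finset.sum_le_card_nsmul _ _ 1 fun i _ => by split_ifs <;> simp).trans (by simp)

lemma real_finCyl_eq_of_ones {μ : Measure Omega} (hμ : Exchangeable μ) {n : ℕ}
    {s t : Fin n → Bool} (h : ones s = ones t) : μ.real (finCyl s) = μ.real (finCyl t) := by
  refine real_finCyl_eq_of_card hμ ?_
  simpa [ones, Fintype.card_subtype] using h

lemma real_finCyl_eq_add (μ : Measure Omega) [IsFiniteMeasure μ] {n : ℕ} (s : Fin n → Bool) :
    μ.real (finCyl s) = μ.real (finCyl (snoc s true)) + μ.real (finCyl (snoc s false)) := by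
  rw [← measureReal_union _ (measurableSet_finCyl _)]
  · congr 1
    ext x
    simp only [finCyl, Set.mem_union, Set.mem_ofPred_eq, Fin.forall_fin_succ', snoc_castSucc,
      snoc_last, Fin.val_castSucc, Fin.val_last]
    cases x n <;> simp
  · refine Set.disjoint_left.2 fun x h1 h2 => ?_
    have h1 := h1 (Fin.last n)
    have h2 := h2 (Fin.last n)
    simp_all

lemma initSeg_succ (n : ℕ) (x : Omega) : initSeg (n + 1) x = snoc (initSeg n x) (x n) := by
  funext i
  refine Fin.lastCases ?_ (fun i => ?_) i <;> simp [initSeg]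

lemma cyl_pref_append (x : Omega) (n : ℕ) (b : Bool) :
    cyl (pref x n ++ [b]) = finCyl (snoc (initSeg n x) b) := by
  rw [← cyl_ofFn, List.ofFn_succ_last]
  simp [pref, initSeg]

lemma forecastOne_pref (μ : Measure Omega) (x : Omega) (n : ℕ) :
    forecastOne μ (pref x n) =
      μ.real (finCyl (snoc (initSeg n x) true)) / μ.real (finCyl (initSeg n x)) := by
  rw [forecastOne, cyl_pref_append, cyl_pref]
  rfl

/-- The input of a prequential test for the theory `μ` along the realization `x`. -/
noncomputable def testInput (μ : Measure Omega) (x : Omega) : ℕ → ℝ × Bool :=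
  fun n => (forecastOne μ (pref x n), x n)

/-- The probability of the first `n` outcomes, computed from the forecasts along the way. -/
noncomputable def prefixProb (n : ℕ) (d : ℕ → ℝ × Bool) : ℝ :=
  ∏ i ∈ Finset.range n, if (d i).2 = true then (d i).1 else 1 - (d i).1

lemma measurable_prefixProb (n : ℕ) : Measurable (prefixProb n) := by
  refine Finset.measurable_fun_prod _ fun i _ => ?_
  refine Measurable.ite ?_ (by fun_prop) (by fun_prop)
  exact (measurable_snd.comp (measurable_pi_apply i)) (measurableSet_singleton true)

lemma prefixProb_testInput {μ : Measure Omega} [IsProbabilityMeasure μ] {x : Omega}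
    (hx : ∀ n, 0 < μ (cyl (pref x n))) (n : ℕ) :
    prefixProb n (testInput μ x) = μ.real (finCyl (initSeg n x)) := by
  induction n with
  | zero =>
    have : finCyl (initSeg 0 x) = Set.univ := by ext; simp [finCyl]
    simp [prefixProb, this]
  | succ n ih =>
    have hpos : μ.real (finCyl (initSeg n x)) ≠ 0 := by
      have := hx n
      rw [cyl_pref] at this
      exact (ENNReal.toReal_pos this.ne' (measure_ne_top _ _)).ne'
    rw [prefixProb, Finset.prod_range_succ, ← prefixProb, ih, initSeg_succ]
    simp only [testInput, forecastOne_pref]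
    have := real_finCyl_eq_add μ (initSeg n x)
    cases hxn : x n
    · simp only [Bool.false_eq_true, if_false]
      field_simp
      linarith
    · simp only [if_true]
      field_simp

/-- A function of theories is readable on `S` if a measurable function of the input of a
prequential test computes it, for exchangeable theories and realizations in `S`. -/
def Readable {β : Type*} [MeasurableSpace β] (S : Set Omega) (φ : Measure Omega → β) : Prop :=
  ∃ c : (ℕ → ℝ × Bool) → β, Measurable c ∧ ∀ μ : Measure Omega, IsProbabilityMeasure μ →
    Exchangeable μ → ∀ x ∈ S, (∀ n, 0 < μ (cyl (pref x n))) → c (testInput μ x) = φ μ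

lemma Readable.sub {S : Set Omega} {φ ψ : Measure Omega → ℝ} (hφ : Readable S φ)
    (hψ : Readable S ψ) : Readable S fun μ => φ μ - ψ μ := by
  obtain ⟨c, hc, h⟩ := hφ
  obtain ⟨c', hc', h'⟩ := hψ
  exact ⟨fun d => c d - c' d, hc.sub hc',
    fun μ hμ he x hx hp => by beta_reduce; rw [h μ hμ he x hx hp, h' μ hμ he x hx hp]⟩

lemma Readable.congr {β : Type*} [MeasurableSpace β] {S : Set Omega} {φ ψ : Measure Omega → β}
    (hφ : Readable S φ)
    (h : ∀ μ : Measure Omega, IsProbabilityMeasure μ → Exchangeable μ → φ μ = ψ μ) :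
    Readable S ψ := by
  obtain ⟨c, hc, h'⟩ := hφ
  exact ⟨c, hc, fun μ hμ he x hx hp => by rw [h' μ hμ he x hx hp, h μ hμ he]⟩

lemma Readable.mono {β : Type*} [MeasurableSpace β] {S S' : Set Omega} {φ : Measure Omega → β}
    (hφ : Readable S φ) (h : S' ⊆ S) : Readable S' φ := by
  obtain ⟨c, hc, h'⟩ := hφ
  exact ⟨c, hc, fun μ hμ he x hx hp => h' μ hμ he x (h hx) hp⟩

/-- Readability may be checked separately on each cylinder of a given length. -/
lemma readable_univ_of_finCyl {φ : Measure Omega → ℝ} (n : ℕ)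
    (h : ∀ t : Fin n → Bool, Readable (finCyl t) φ) : Readable Set.univ φ := by
  classical
  choose c hc hcφ using h
  refine ⟨fun d => ∑ t, if (fun i : Fin n => (d i).2) = t then c t d else 0, ?_, ?_⟩
  · refine Finset.measurable_fun_sum _ fun t _ => Measurable.ite ?_ (hc t) measurable_const
    have : Measurable fun d : ℕ → ℝ × Bool => fun i : Fin n => (d i).2 := by fun_prop
    exact this (measurableSet_singleton t)
  · intro μ hμ he x _ hp
    have : (fun i : Fin n => (testInput μ x i).2) = initSeg n x := rfl
    beta_reduce
    rw [this, Finset.sum_ite_eq, if_pos (Finset.mem_univ _)]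
    exact hcφ _ μ hμ he x (mem_finCyl.2 rfl) hp

lemma real_word_eq_add {μ : Measure Omega} [IsFiniteMeasure μ] (hμ : Exchangeable μ) {n k : ℕ}
    (hk : k ≤ n) :
    μ.real (finCyl (word n k)) =
      μ.real (finCyl (word (n + 1) (k + 1))) + μ.real (finCyl (word (n + 1) k)) := by
  rw [real_finCyl_eq_add μ (word n k)]
  congr 1 <;> apply real_finCyl_eq_of_ones hμ <;> simp [ones_snoc, ones_word]
  omega

lemma readable_word (n : ℕ) :
    ∀ k ≤ n, Readable Set.univ fun μ => μ.real (finCyl (word n k)) := by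
  induction n with
  | zero =>
    refine fun k _ => ⟨fun _ => 1, measurable_const, fun μ hμ _ x _ _ => ?_⟩
    have : finCyl (word 0 k) = Set.univ := by ext; simp [finCyl]
    simp [this]
  | succ n ih =>
    refine fun k hk => readable_univ_of_finCyl (n + 1) fun t => ?_
    have anchor : Readable (finCyl t) fun μ => μ.real (finCyl (word (n + 1) (ones t))) := by
      refine ⟨prefixProb (n + 1), measurable_prefixProb _, fun μ hμ he x hx hp => ?_⟩
      rw [prefixProb_testInput hp, mem_finCyl.1 hx]
      exact real_finCyl_eq_of_ones he (by simp [ones_word, ones_le])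
    rcases le_total (ones t) k with h | h
    · induction k, h using Nat.le_induction with
      | base => exact anchor
      | succ j hj ihj =>
        refine (((ih j (by omega)).mono (Set.subset_univ _)).sub (ihj (by omega))).congr ?_
        intro μ _ he
        rw [real_word_eq_add he (by omega)]
        ring
    · induction h using Nat.decreasingInduction with
      | self => exact anchor
      | of_succ j hj ihj =>
        have := ones_le t
        refine (((ih j (by omega)).mono (Set.subset_univ _)).sub (ihj (by omega))).congr ?_
        intro μ _ he
        rw [real_word_eq_add he (by omega)]
        ring

lemma readable_finCyl {n : ℕ} (s : Fin n → Bool) :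
    Readable Set.univ fun μ => μ.real (finCyl s) :=
  (readable_word n (ones s) (ones_le s)).congr fun _ _ he =>
    real_finCyl_eq_of_ones he (by simp [ones_word, ones_le])

/-- The probability of every Borel event can be read off the forecasts along one realization. -/
lemma readable_measure {B : Set Omega} (hB : MeasurableSet B) :
    Readable Set.univ fun μ => μ B := by
  induction B, hB using MeasurableSpace.induction_on_inter
    measurableSpace_eq_generateFrom_cylinders isPiSystem_cylinders with
  | empty => exact ⟨fun _ => 0, measurable_const, by simp⟩
  | basic t ht =>
    obtain ⟨x, n, rfl⟩ := ht
    obtain ⟨c, hc, h⟩ := readable_finCyl (initSeg n x)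
    refine ⟨fun d => ENNReal.ofReal (c d), hc.ennreal_ofReal, fun μ hμ he y hy hp => ?_⟩
    beta_reduce
    rw [h μ hμ he y hy hp, finCyl_initSeg, ofReal_measureReal]
  | compl t ht ih =>
    obtain ⟨c, hc, h⟩ := ih
    refine ⟨fun d => 1 - c d, measurable_const.sub hc, fun μ hμ he y hy hp => ?_⟩
    beta_reduce
    rw [h μ hμ he y hy hp, prob_compl_eq_one_sub ht]
  | iUnion f hd hf ih =>
    choose c hc h using ih
    refine ⟨fun d => ∑' i, c i d, Measurable.tsum hc, fun μ hμ he y hy hp => ?_⟩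
    beta_reduce
    rw [measure_iUnion hd hf]
    exact tsum_congr fun i => h i μ hμ he y hy hp

/-! ### Empirical frequencies under exchangeable theories -/

/-- The numerical value of the `i`-th outcome. -/
noncomputable def outcome (i : ℕ) (x : Omega) : ℝ := if x i = true then 1 else 0

/-- The frequency of ones among the first `N` outcomes. -/
noncomputable def freq (N : ℕ) (x : Omega) : ℝ := (∑ i ∈ Finset.range N, outcome i x) / N

lemma continuous_outcome (i : ℕ) : Continuous (outcome i) :=
  (continuous_of_discreteTopology (f := fun b : Bool => if b = true then (1 : ℝ) else 0)).comp
    (continuous_apply i)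

lemma continuous_freq (N : ℕ) : Continuous (freq N) :=
  (continuous_finsetSum _ fun i _ => continuous_outcome i).div_const _

lemma integrable_of_continuous (μ : Measure Omega) [IsFiniteMeasure μ] {f : Omega → ℝ}
    (hf : Continuous f) : Integrable f μ :=
  hf.integrable_of_hasCompactSupport (HasCompactSupport.of_compactSpace f)

lemma integral_outcome {μ : Measure Omega} [IsProbabilityMeasure μ] (hμ : Exchangeable μ) (i : ℕ) :
    ∫ x, outcome i x ∂μ = μ.real (finCyl fun _ : Fin 1 => true) := by
  rw [← real_injective_marginal hμ (g := fun _ : Fin 1 => i)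
    (fun a b _ => Subsingleton.elim a b), ← integral_indicator_one]
  · congr 1
    funext x
    simp [outcome, Set.indicator_apply]
  · have : {x : Omega | ∀ _ : Fin 1, x i = true} = (fun x : Omega => x i) ⁻¹' {true} := by
      ext; simp
    rw [this]
    exact (measurable_pi_apply i) (measurableSet_singleton true)

lemma integral_outcome_mul {μ : Measure Omega} [IsProbabilityMeasure μ] (hμ : Exchangeable μ)
    {i j : ℕ} (hij : i ≠ j) :
    ∫ x, outcome i x * outcome j x ∂μ = μ.real (finCyl fun _ : Fin 2 => true) := by
  rw [← real_injective_marginal hμ (g := ![i, j]), ← integral_indicator_one]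
  · congr 1
    funext x
    simp only [outcome, Set.indicator_apply, Set.mem_ofPred_eq, Fin.forall_fin_two,
      Matrix.cons_val_zero, Matrix.cons_val_one, Pi.one_apply]
    split_ifs <;> simp_all
  · have : {x : Omega | ∀ k : Fin 2, x (![i, j] k) = true} =
        (fun x : Omega => x i) ⁻¹' {true} ∩ (fun x : Omega => x j) ⁻¹' {true} := by
      ext; simp [Fin.forall_fin_two]
    rw [this]
    exact ((measurable_pi_apply i) (measurableSet_singleton true)).inter
      ((measurable_pi_apply j) (measurableSet_singleton true))
  · intro a b
    fin_cases a <;> fin_cases b <;> simp [hij, hij.symm]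

lemma integral_freq {μ : Measure Omega} [IsProbabilityMeasure μ] (hμ : Exchangeable μ) {N : ℕ}
    (hN : 0 < N) : ∫ x, freq N x ∂μ = μ.real (finCyl fun _ : Fin 1 => true) := by
  simp only [freq]
  rw [integral_div, integral_finsetSum _ fun i _ =>
    integrable_of_continuous μ (continuous_outcome i)]
  simp only [integral_outcome hμ, Finset.sum_const, Finset.card_range, nsmul_eq_mul]
  field_simp

lemma integral_freq_mul {μ : Measure Omega} [IsProbabilityMeasure μ] (hμ : Exchangeable μ)
    {N M : ℕ} (hN : 0 < N) (hNM : N ≤ M) :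
    ∫ x, freq N x * freq M x ∂μ = μ.real (finCyl fun _ : Fin 2 => true) +
      (μ.real (finCyl fun _ : Fin 1 => true) - μ.real (finCyl fun _ : Fin 2 => true)) / M := by
  have hM : 0 < M := hN.trans_le hNM
  set a := μ.real (finCyl fun _ : Fin 1 => true)
  set b := μ.real (finCyl fun _ : Fin 2 => true)
  have hij : ∀ i j, ∫ x, outcome i x * outcome j x ∂μ = b + if j = i then a - b else 0 := by
    intro i j
    split_ifs with h
    · subst h
      have : ∀ x, outcome j x * outcome j x = outcome j x := fun x => by
        simp only [outcome]; split_ifs <;> simp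
      simp only [this, integral_outcome hμ]
      simp [a]
    · rw [integral_outcome_mul hμ (Ne.symm h), add_zero]
  have hcont : ∀ i j, Integrable (fun x => outcome i x * outcome j x) μ := fun i j =>
    integrable_of_continuous μ ((continuous_outcome i).mul (continuous_outcome j))
  have hexp : ∀ x, freq N x * freq M x =
      (∑ i ∈ Finset.range N, ∑ j ∈ Finset.range M, outcome i x * outcome j x) / (N * M) := by
    intro x
    rw [freq, freq, div_mul_div_comm, Finset.sum_mul_sum]
  simp only [hexp]
  rw [integral_div, integral_finsetSum _ fun i _ => integrable_finsetSum _ fun j _ => hcont i j]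
  have hin : ∀ i ∈ Finset.range N, ∫ x, ∑ j ∈ Finset.range M, outcome i x * outcome j x ∂μ =
      M * b + (a - b) := by
    intro i hi
    rw [integral_finsetSum _ fun j _ => hcont i j]
    simp only [hij, Finset.sum_add_distrib, Finset.sum_const, Finset.card_range, nsmul_eq_mul,
      Finset.sum_ite_eq']
    rw [if_pos (Finset.mem_range.2 ((Finset.mem_range.1 hi).trans_le hNM))]
  rw [Finset.sum_congr rfl hin]
  simp only [Finset.sum_const, Finset.card_range, nsmul_eq_mul]
  have : (N : ℝ) ≠ 0 := by positivity
  have : (M : ℝ) ≠ 0 := by positivity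
  field_simp

lemma integral_freq_sub_sq_le {μ : Measure Omega} [IsProbabilityMeasure μ] (hμ : Exchangeable μ)
    {N M : ℕ} (hN : 0 < N) (hNM : N ≤ M) : ∫ x, (freq N x - freq M x) ^ 2 ∂μ ≤ 1 / N := by
  have hM : 0 < M := hN.trans_le hNM
  have hint : ∀ K L, Integrable (fun x => freq K x * freq L x) μ := fun K L =>
    integrable_of_continuous μ ((continuous_freq K).mul (continuous_freq L))
  have : ∀ x, (freq N x - freq M x) ^ 2 =
      freq N x * freq N x - 2 * (freq N x * freq M x) + freq M x * freq M x := fun x => by ring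
  simp only [this]
  rw [integral_add (f := fun x => freq N x * freq N x - 2 * (freq N x * freq M x))
    ((hint N N).sub ((hint N M).const_mul 2)) (hint M M),
    integral_sub (hint N N) ((hint N M).const_mul 2), integral_const_mul,
    integral_freq_mul hμ hN le_rfl, integral_freq_mul hμ hN hNM, integral_freq_mul hμ hM le_rfl]
  set a := μ.real (finCyl fun _ : Fin 1 => true)
  set b := μ.real (finCyl fun _ : Fin 2 => true)
  have ha : a ≤ 1 := measureReal_le_one
  have hb : 0 ≤ b := measureReal_nonneg
  have hab : b ≤ a := by
    refine measureReal_mono fun x hx i => ?_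
    have := hx 0
    fin_cases i
    exact this
  have h1 : (a - b) / N ≤ 1 / N := by gcongr; linarith
  have h2 : 0 ≤ (a - b) / M := div_nonneg (by linarith) (by positivity)
  linarith

lemma real_le_of_integral_sq_le {μ : Measure Omega} [IsProbabilityMeasure μ] {f : Omega → ℝ}
    (hf : Continuous f) {c v : ℝ} (hc : 0 < c) (hv : ∫ x, f x ^ 2 ∂μ ≤ v) :
    μ.real {x | c ≤ |f x|} ≤ v / c ^ 2 := by
  have h := mul_meas_ge_le_integral_of_nonneg (μ := μ) (f := fun x => f x ^ 2)
    (Eventually.of_forall fun x => sq_nonneg (f x)) (integrable_of_continuous μ (hf.pow 2)) (c ^ 2)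
  have hset : {x | c ^ 2 ≤ f x ^ 2} = {x | c ≤ |f x|} := by
    ext x
    simp only [Set.mem_ofPred_eq]
    rw [sq_le_sq, abs_of_pos hc]
  rw [hset] at h
  rw [le_div_iff₀ (by positivity), mul_comm]
  exact h.trans hv

/-- The realizations whose frequency of ones at time `128 ^ n` lies in an annulus of scale
`4⁻¹ ^ n` around `q`. -/
def annulus (q : ℚ) (n : ℕ) : Set Omega :=
  {x | (4⁻¹ : ℝ) ^ n / 2 < |freq (128 ^ n) x - q| ∧ |freq (128 ^ n) x - q| < (4⁻¹ : ℝ) ^ n}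

/-- The realizations visiting an annulus around `q` at some stage from `l` on. -/
def visits (q : ℚ) (l : ℕ) : Set Omega := ⋃ n ≥ l, annulus q n

lemma isOpen_annulus (q : ℚ) (n : ℕ) : IsOpen (annulus q n) := by
  have : Continuous fun x => |freq (128 ^ n) x - q| :=
    ((continuous_freq _).sub continuous_const).abs
  exact (isOpen_lt continuous_const this).inter (isOpen_lt this continuous_const)

lemma isOpen_visits (q : ℚ) (l : ℕ) : IsOpen (visits q l) :=
  isOpen_iUnion fun n => isOpen_iUnion fun _ => isOpen_annulus q n

lemma visits_antitone (q : ℚ) : Antitone (visits q) := fun _ _ h =>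
  Set.biUnion_subset_biUnion_left fun _ hn => le_trans h hn

/-- A sequence with geometrically small increments visits the annuli around `q` finitely often. -/
lemma eventually_not_annulus {f : ℕ → ℝ} {q : ℝ} {n : ℕ} (hn : 3 ≤ n)
    (hf : ∀ k ≥ n, |f k - f (k + 1)| < (8⁻¹ : ℝ) ^ k) (hq : (4⁻¹ : ℝ) ^ n / 2 < |f n - q|)
    {m : ℕ} (hm : n < m) : (4⁻¹ : ℝ) ^ m < |f m - q| := by
  have key : ∀ j, |f n - f (n + j)| ≤ 8 / 7 * ((8⁻¹ : ℝ) ^ n - (8⁻¹ : ℝ) ^ (n + j)) := by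
    intro j
    induction j with
    | zero => simp
    | succ j ih =>
      have h1 := hf (n + j) (by omega)
      have h2 := abs_sub_le (f n) (f (n + j)) (f (n + j + 1))
      have h3 : (8⁻¹ : ℝ) ^ (n + j + 1) = 8⁻¹ * (8⁻¹ : ℝ) ^ (n + j) := by ring
      rw [← add_assoc, h3]
      linarith
  obtain ⟨j, rfl⟩ := Nat.exists_eq_add_of_le hm.le
  have h1 := key j
  have h2 := abs_sub_le (f n) (f (n + j)) q
  have h3 : (8⁻¹ : ℝ) ^ n ≤ (4⁻¹ : ℝ) ^ n * (1 / 8) := by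
    have : (8⁻¹ : ℝ) ^ n = (4⁻¹ : ℝ) ^ n * (2⁻¹ : ℝ) ^ n := by rw [← mul_pow]; norm_num
    rw [this]
    gcongr
    calc (2⁻¹ : ℝ) ^ n ≤ (2⁻¹ : ℝ) ^ 3 := pow_le_pow_of_le_one (by norm_num) (by norm_num) hn
      _ = 1 / 8 := by norm_num
  have h4 : (4⁻¹ : ℝ) ^ (n + j) ≤ (4⁻¹ : ℝ) ^ n * 4⁻¹ := by
    rw [← pow_succ]
    exact pow_le_pow_of_le_one (by norm_num) (by norm_num) (by omega)
  have h5 : (0 : ℝ) < (8⁻¹ : ℝ) ^ (n + j) := by positivity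
  have h6 : (0 : ℝ) < (4⁻¹ : ℝ) ^ n := by positivity
  linarith

lemma measure_iInter_visits {μ : Measure Omega} [IsProbabilityMeasure μ] (hμ : Exchangeable μ)
    (q : ℚ) : μ (⋂ l, visits q l) = 0 := by
  let E : ℕ → Set Omega := fun n =>
    {x | (8⁻¹ : ℝ) ^ n ≤ |freq (128 ^ n) x - freq (128 ^ (n + 1)) x|}
  have hE : ∀ n, μ (E n) ≤ ENNReal.ofReal ((2⁻¹ : ℝ) ^ n) := by
    intro n
    rw [← ofReal_measureReal]
    refine ENNReal.ofReal_le_ofReal ((real_le_of_integral_sq_le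
      ((continuous_freq _).sub (continuous_freq _)) (by positivity)
      (integral_freq_sub_sq_le hμ (by positivity)
        (Nat.pow_le_pow_right (by norm_num) n.le_succ))).trans_eq ?_)
    push_cast
    rw [← pow_mul, mul_comm n 2, pow_mul, one_div, ← inv_pow, ← div_pow]
    norm_num
  have hsum : ∑' n, μ (E n) ≠ ∞ := by
    refine ne_top_of_le_ne_top ?_ (ENNReal.tsum_le_tsum hE)
    rw [← ENNReal.ofReal_tsum_of_nonneg (fun n => by positivity)
      (summable_geometric_of_lt_one (by norm_num) (by norm_num))]
    exact ENNReal.ofReal_ne_top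
  refine measure_mono_null (t := {x | ¬ ∀ᶠ n in atTop, x ∉ E n}) ?_ (ae_eventually_notMem hsum)
  intro x hx hE
  obtain ⟨n₀, hn₀⟩ := eventually_atTop.1 hE
  have hvis : ∀ l, ∃ n ≥ l, x ∈ annulus q n := fun l => by
    simpa [visits] using Set.mem_iInter.1 hx l
  obtain ⟨n, hn, hxn⟩ := hvis (max 3 n₀)
  obtain ⟨m, hm, hxm⟩ := hvis (n + 1)
  refine lt_asymm (eventually_not_annulus (f := fun k => freq (128 ^ k) x) (by omega)
    (fun k hk => ?_) hxn.1 (Nat.lt_of_succ_le hm)) hxm.2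
  exact not_le.1 (hn₀ k (by omega))

lemma tendsto_measure_visits {μ : Measure Omega} [IsProbabilityMeasure μ] (hμ : Exchangeable μ)
    (q : ℚ) : Tendsto (fun l => μ (visits q l)) atTop (𝓝 0) := by
  rw [← measure_iInter_visits hμ q]
  exact tendsto_measure_iInter_atTop
    (fun l => (isOpen_visits q l).measurableSet.nullMeasurableSet) (visits_antitone q)
    ⟨0, measure_ne_top _ _⟩

/-! ### Mixtures of coin tosses are dense among exchangeable theories -/

/-- The theory of independent tosses of a coin with bias `θ`. -/
noncomputable def iid (θ : unitInterval) : Measure Omega :=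
  Measure.infinitePi fun _ : ℕ => ProbabilityTheory.bernoulliMeasure true false θ

instance (θ : unitInterval) : IsProbabilityMeasure (iid θ) := by
  unfold iid; infer_instance

lemma real_finCyl_iid (θ : unitInterval) {n : ℕ} (s : Fin n → Bool) :
    (iid θ).real (finCyl s) = ∏ i, if s i = true then (θ : ℝ) else 1 - θ := by
  classical
  let t : ℕ → Set Bool := fun i => if h : i < n then {s ⟨i, h⟩} else Set.univ
  have ht : finCyl s = Set.pi (Finset.range n) t := by
    ext x
    simp only [finCyl, Set.mem_ofPred_eq, Set.mem_pi, Finset.coe_range, Set.mem_Iio, t]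
    constructor
    · intro h i hi
      simpa [hi] using h ⟨i, hi⟩
    · intro h i
      simpa using h i i.2
  rw [ht, measureReal_def, iid, Measure.infinitePi_pi _ fun _ _ => MeasurableSet.of_discrete,
    ENNReal.toReal_prod, Finset.prod_range]
  refine Finset.prod_congr rfl fun i _ => ?_
  rw [← measureReal_def, ProbabilityTheory.bernoulliMeasure_real_apply _ MeasurableSet.of_discrete]
  cases h : s i <;> simp [t, h]

lemma exchangeable_of_real {μ : Measure Omega} [IsFiniteMeasure μ]
    (h : ∀ (n : ℕ) (s : Fin n → Bool) (π : Equiv.Perm (Fin n)),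
      μ.real (finCyl (s ∘ π)) = μ.real (finCyl s)) : Exchangeable μ := by
  intro σ π
  rw [cyl_ofFn, cyl_eq_finCyl]
  refine (ENNReal.toReal_eq_toReal_iff' (measure_ne_top _ _) (measure_ne_top _ _)).1 ?_
  exact (h _ σ.get π).symm

lemma exchangeable_iid (θ : unitInterval) : Exchangeable (iid θ) :=
  exchangeable_of_real fun n s π => by
    rw [real_finCyl_iid, real_finCyl_iid]
    exact Equiv.prod_comp π fun i => if s i = true then (θ : ℝ) else 1 - θ

/-- The type of exchangeable theories. -/
abbrev ExchangeableTheory : Type :=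
  {μ : ProbabilityMeasure Omega // Exchangeable (μ : Measure Omega)}

/-- The mixture with weights `w` of coin tosses with biases `θ`. -/
noncomputable def mixture {ι : Type*} [Fintype ι] (w : ι → ℝ) (θ : ι → unitInterval) :
    Measure Omega := ∑ i, ENNReal.ofReal (w i) • iid (θ i)

lemma mixture_real {ι : Type*} [Fintype ι] {w : ι → ℝ} (hw : ∀ i, 0 ≤ w i)
    (θ : ι → unitInterval) (A : Set Omega) :
    (mixture w θ).real A = ∑ i, w i * (iid (θ i)).real A := by
  rw [mixture, measureReal_def, Measure.finsetSum_apply, ENNReal.toReal_sum]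
  · simp [measureReal_def, hw]
  · intro i _
    simp [ENNReal.mul_eq_top]

lemma isProbabilityMeasure_mixture {ι : Type*} [Fintype ι] {w : ι → ℝ} (hw : ∀ i, 0 ≤ w i)
    (hw1 : ∑ i, w i = 1) (θ : ι → unitInterval) : IsProbabilityMeasure (mixture w θ) := by
  rw [isProbabilityMeasure_iff_real, mixture_real hw]
  simpa using hw1

/-- A finite mixture of coin tosses as an exchangeable theory. -/
noncomputable def mixtureTheory {ι : Type*} [Fintype ι] {w : ι → ℝ} (hw : ∀ i, 0 ≤ w i)
    (hw1 : ∑ i, w i = 1) (θ : ι → unitInterval) : ExchangeableTheory :=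
  ⟨⟨mixture w θ, isProbabilityMeasure_mixture hw hw1 θ⟩, by
    have := isProbabilityMeasure_mixture hw hw1 θ
    show Exchangeable (mixture w θ)
    refine exchangeable_of_real fun n s π => ?_
    simp only [mixture_real hw, real_finCyl_comp_perm (exchangeable_iid _)]⟩

lemma integral_freq_sub_bias_sq_le (θ : unitInterval) {N : ℕ} (hN : 0 < N) :
    ∫ x, (freq N x - θ) ^ 2 ∂(iid θ) ≤ 1 / N := by
  have he := exchangeable_iid θ
  have hint : Integrable (fun x => freq N x * freq N x) (iid θ) :=
    integrable_of_continuous _ ((continuous_freq N).mul (continuous_freq N))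
  have hint' : Integrable (freq N) (iid θ) := integrable_of_continuous _ (continuous_freq N)
  have : ∀ x, (freq N x - θ) ^ 2 =
      freq N x * freq N x - 2 * θ * freq N x + (θ : ℝ) ^ 2 := fun x => by ring
  simp only [this]
  rw [integral_add (f := fun x => freq N x * freq N x - 2 * θ * freq N x)
    (hint.sub (hint'.const_mul _)) (integrable_const _), integral_sub hint (hint'.const_mul _),
    integral_const_mul, integral_freq_mul he hN le_rfl, integral_freq he hN]
  simp only [real_finCyl_iid, if_true, Finset.prod_const, Finset.card_univ, Fintype.card_fin,
    integral_const, probReal_univ, smul_eq_mul]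
  have h0 := θ.2.1
  have h1 := θ.2.2
  have : ((θ : ℝ) ^ 1 - (θ : ℝ) ^ 2) / N ≤ 1 / N := by gcongr; nlinarith
  nlinarith

/-- There are biases close to `q` whose coin tosses are likely to visit an annulus around `q`. -/
lemma exists_bias {q : ℚ} (hq0 : 0 ≤ q) (hq1 : q ≤ 1) (n : ℕ) :
    ∃ θ : unitInterval, |(θ : ℝ) - q| ≤ (4⁻¹ : ℝ) ^ n ∧
      ∀ l ≤ n, 1 - 16 * (8⁻¹ : ℝ) ^ n ≤ (iid θ).real (visits q l) := by
  have hq0 : (0 : ℝ) ≤ q := by exact_mod_cast hq0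
  have hq1 : (q : ℝ) ≤ 1 := by exact_mod_cast hq1
  rcases Nat.eq_zero_or_pos n with rfl | hn
  · refine ⟨⟨q, hq0, hq1⟩, by simp, fun l _ => ?_⟩
    refine le_trans ?_ measureReal_nonneg
    norm_num
  have h4 : (0 : ℝ) < (4⁻¹ : ℝ) ^ n := by positivity
  have h4' : (4⁻¹ : ℝ) ^ n ≤ 4⁻¹ := pow_le_of_le_one (by norm_num) (by norm_num) (by omega)
  obtain ⟨θ, hθ⟩ : ∃ θ : unitInterval, |(θ : ℝ) - q| = 3 / 4 * (4⁻¹ : ℝ) ^ n := by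
    rcases le_total (q : ℝ) (1 / 2) with h | h
    · refine ⟨⟨q + 3 / 4 * (4⁻¹ : ℝ) ^ n, by linarith, by linarith⟩, ?_⟩
      simp only [add_sub_cancel_left]
      exact abs_of_pos (by linarith)
    · refine ⟨⟨q - 3 / 4 * (4⁻¹ : ℝ) ^ n, by linarith, by linarith⟩, ?_⟩
      simp only [sub_sub_cancel_left, abs_neg]
      exact abs_of_pos (by linarith)
  refine ⟨θ, by linarith, fun l hl => ?_⟩
  have hsub : annulus q n ⊆ visits q l := Set.subset_biUnion_of_mem (u := annulus q) hl
  refine le_trans ?_ (measureReal_mono hsub)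
  have hc : (annulus q n)ᶜ ⊆ {x | (4⁻¹ : ℝ) ^ n / 4 ≤ |freq (128 ^ n) x - θ|} := by
    intro x hx
    by_contra hlt
    refine hx ?_
    simp only [Set.mem_ofPred_eq, not_le] at hlt
    have h1 := abs_sub_le (freq (128 ^ n) x) θ q
    have h2 := abs_sub_le (θ : ℝ) (freq (128 ^ n) x) q
    rw [abs_sub_comm (θ : ℝ) (freq (128 ^ n) x)] at h2
    exact ⟨by linarith, by linarith⟩
  have h1 := real_le_of_integral_sq_le (μ := iid θ) (f := fun x => freq (128 ^ n) x - θ)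
    ((continuous_freq _).sub continuous_const) (c := (4⁻¹ : ℝ) ^ n / 4) (by positivity)
    (integral_freq_sub_bias_sq_le θ (by positivity))
  have h2 := (measureReal_mono hc).trans h1
  rw [probReal_compl_eq_one_sub (isOpen_annulus q n).measurableSet] at h2
  have h3 : 1 / ((128 ^ n : ℕ) : ℝ) / ((4⁻¹ : ℝ) ^ n / 4) ^ 2 = 16 * (8⁻¹ : ℝ) ^ n := by
    have : (128 : ℝ) ^ n = 8 ^ n * (4 ^ n) ^ 2 := by
      rw [← pow_mul, mul_comm n 2, pow_mul, ← mul_pow]; norm_num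
    push_cast
    rw [this, inv_pow, inv_pow]
    field_simp
    norm_num
  linarith

/-- The fraction of sequences of `n` draws from `N` items that have no repetition tends to one. -/
lemma tendsto_descFactorial_div (n : ℕ) :
    Tendsto (fun N : ℕ => (((N + 1).descFactorial n : ℕ) : ℝ) / ((N : ℝ) + 1) ^ n) atTop (𝓝 1) := by
  have hz : ∀ᶠ N : ℕ in atTop, (N : ℝ) ^ n ≠ 0 := by
    filter_upwards [eventually_gt_atTop 0] with N hN
    positivity
  have h := ((Asymptotics.isEquivalent_iff_tendsto_one hz).1
    (isEquivalent_descFactorial n)).comp (tendsto_add_atTop_nat 1)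
  refine h.congr fun N => ?_
  simp

/-- The frequency of ones in a nonempty word. -/
def wordFreq {N : ℕ} (s : Fin (N + 1) → Bool) : ℚ := ones s / (N + 1)

lemma wordFreq_nonneg {N : ℕ} (s : Fin (N + 1) → Bool) : 0 ≤ wordFreq s := by
  unfold wordFreq; positivity

lemma wordFreq_le_one {N : ℕ} (s : Fin (N + 1) → Bool) : wordFreq s ≤ 1 := by
  unfold wordFreq
  rw [div_le_one (by positivity)]
  exact_mod_cast ones_le s

lemma prod_wordFreq {N n : ℕ} (s : Fin (N + 1) → Bool) (σ : Fin n → Bool) :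
    ∏ j, (if σ j = true then (wordFreq s : ℝ) else 1 - wordFreq s) =
      (∑ g : Fin n → Fin (N + 1), if ∀ j, s (g j) = σ j then 1 else 0) / ((N : ℝ) + 1) ^ n := by
  have h1 : ∀ j, (if σ j = true then (wordFreq s : ℝ) else 1 - wordFreq s) =
      (∑ i, if s i = σ j then 1 else 0) / ((N : ℝ) + 1) := by
    intro j
    have htrue : (wordFreq s : ℝ) = (∑ i, if s i = true then 1 else 0) / ((N : ℝ) + 1) := by
      simp [wordFreq, ones]
    cases σ j
    · have : ∀ i, (if s i = false then 1 else 0 : ℝ) = 1 - if s i = true then 1 else 0 := by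
        intro i
        cases s i <;> simp
      simp only [Bool.false_eq_true, if_false, htrue, this, Finset.sum_sub_distrib]
      simp only [Finset.sum_const, Finset.card_univ, Fintype.card_fin, nsmul_eq_mul]
      have : (N : ℝ) + 1 ≠ 0 := by positivity
      field_simp
      push_cast
      ring
    · simpa using htrue
  simp only [h1, Finset.prod_div_distrib, Finset.prod_const, Finset.card_univ, Fintype.card_fin]
  rw [Finset.prod_univ_sum, Fintype.piFinset_univ]
  congr 1
  refine Finset.sum_congr rfl fun g _ => ?_
  simp [Finset.prod_boole]

/-- Mixing coin tosses whose biases are empirical frequencies approximates an exchangeable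
theory. -/
lemma abs_sum_mul_prod_wordFreq_sub_le {μ : Measure Omega} [IsProbabilityMeasure μ]
    (hμ : Exchangeable μ) {n : ℕ} (σ : Fin n → Bool) (N : ℕ) :
    |∑ s : Fin (N + 1) → Bool, μ.real (finCyl s) *
        ∏ j, (if σ j = true then (wordFreq s : ℝ) else 1 - wordFreq s) - μ.real (finCyl σ)| ≤
      1 - (((N + 1).descFactorial n : ℕ) : ℝ) / ((N : ℝ) + 1) ^ n := by
  classical
  set a := μ.real (finCyl σ) with ha
  let m : (Fin n → Fin (N + 1)) → ℝ := fun g => μ.real {x | ∀ j, x (g j) = σ j}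
  have hM : (0 : ℝ) < ((N : ℝ) + 1) ^ n := by positivity
  have hm : ∀ g, m g = ∑ s, if ∀ j, s (g j) = σ j then μ.real (finCyl s) else 0 := fun g =>
    real_initSeg_preimage μ (N + 1) fun s => ∀ j, s (g j) = σ j
  have h1 : ∑ s : Fin (N + 1) → Bool, μ.real (finCyl s) *
      ∏ j, (if σ j = true then (wordFreq s : ℝ) else 1 - wordFreq s) =
      (∑ g, m g) / ((N : ℝ) + 1) ^ n := by
    simp only [prod_wordFreq, hm, mul_div_assoc', ← Finset.sum_div, Finset.mul_sum]
    rw [Finset.sum_comm]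
    simp
  have hcard : ∑ g : Fin n → Fin (N + 1), (if Function.Injective g then (0 : ℝ) else 1) =
      ((N : ℝ) + 1) ^ n - ((N + 1).descFactorial n : ℕ) := by
    have : ∀ g : Fin n → Fin (N + 1), (if Function.Injective g then (0 : ℝ) else 1) =
        1 - if Function.Injective g then 1 else 0 := fun g => by split_ifs <;> simp
    simp only [this, Finset.sum_sub_distrib, Finset.sum_boole, Finset.sum_const, nsmul_eq_mul,
      mul_one, Finset.card_univ, Fintype.card_fun, Fintype.card_fin]
    have hinj : (Finset.univ.filter fun g : Fin n → Fin (N + 1) => Function.Injective g).card =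
        (N + 1).descFactorial n := by
      rw [← Fintype.card_subtype, Fintype.card_congr
        (Equiv.subtypeInjectiveEquivEmbedding (Fin n) (Fin (N + 1))), Fintype.card_embedding_eq]
      simp
    rw [hinj]
    push_cast
    ring
  have h2 : |∑ g, m g - a * ((N : ℝ) + 1) ^ n| ≤
      ((N : ℝ) + 1) ^ n - ((N + 1).descFactorial n : ℕ) := by
    have : ∑ g, m g - a * ((N : ℝ) + 1) ^ n = ∑ g, (m g - a) := by
      simp [Finset.sum_sub_distrib, mul_comm]
    rw [this, ← hcard]
    refine (Finset.abs_sum_le_sum_abs _ _).trans (Finset.sum_le_sum fun g _ => ?_)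
    split_ifs with hg
    · have : m g = a := real_injective_marginal hμ (Fin.val_injective.comp hg) σ
      simp [this]
    · rw [abs_sub_le_iff]
      have h1 : m g ≤ 1 := measureReal_le_one
      have h2 : 0 ≤ m g := measureReal_nonneg
      have h3 : a ≤ 1 := measureReal_le_one
      have h4 : 0 ≤ a := measureReal_nonneg
      constructor <;> linarith
  rw [h1, div_sub' hM.ne', one_sub_div hM.ne', abs_div, abs_of_pos hM, mul_comm _ a]
  gcongr

lemma tendsto_sum_mul_prod_wordFreq {μ : Measure Omega} [IsProbabilityMeasure μ]
    (hμ : Exchangeable μ) {n : ℕ} (σ : Fin n → Bool) :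
    Tendsto (fun N : ℕ => ∑ s : Fin (N + 1) → Bool, μ.real (finCyl s) *
        ∏ j, (if σ j = true then (wordFreq s : ℝ) else 1 - wordFreq s)) atTop
      (𝓝 (μ.real (finCyl σ))) := by
  refine tendsto_iff_norm_sub_tendsto_zero.2 (squeeze_zero (fun _ => norm_nonneg _)
    (fun N => abs_sum_mul_prod_wordFreq_sub_le hμ σ N) ?_)
  simpa using (tendsto_descFactorial_div n).const_sub 1

/-! ### Open sets of full measure for generic theories -/

/-- Theories that are likely to visit annuli around some rational number are dense. -/
lemma dense_visits (L : ℚ → ℕ) {r : ℝ} (hr : r < 1) :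
    Dense {μ : ExchangeableTheory | r < (μ.1 : Measure Omega).real (⋃ q, visits q (L q))} := by
  intro μ
  have hw : ∀ N (s : Fin (N + 1) → Bool), 0 ≤ (μ.1 : Measure Omega).real (finCyl s) :=
    fun _ _ => measureReal_nonneg
  have hw1 : ∀ N, ∑ s : Fin (N + 1) → Bool, (μ.1 : Measure Omega).real (finCyl s) = 1 :=
    fun N => sum_real_finCyl _ _
  let q : ∀ N, (Fin (N + 1) → Bool) → unitInterval := fun N s =>
    ⟨wordFreq s, by exact_mod_cast wordFreq_nonneg s, by exact_mod_cast wordFreq_le_one s⟩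
  have hlim : Tendsto (fun N => mixtureTheory (hw N) (hw1 N) (q N)) atTop (𝓝 μ) := by
    refine tendsto_subtype_rng.2 (tendsto_of_tendsto_finCyl fun n σ => ?_)
    simp only [mixtureTheory, ProbabilityMeasure.coe_mk, mixture_real (hw _), real_finCyl_iid]
    exact tendsto_sum_mul_prod_wordFreq μ.2 σ
  refine isClosed_closure.mem_of_tendsto hlim (Eventually.of_forall fun N => ?_)
  choose θ hθ hvis using fun n (s : Fin (N + 1) → Bool) =>
    exists_bias (wordFreq_nonneg s) (wordFreq_le_one s) n
  have hθlim : ∀ s, Tendsto (fun n => (θ n s : ℝ)) atTop (𝓝 (wordFreq s : ℝ)) := fun s =>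
    tendsto_iff_norm_sub_tendsto_zero.2 (squeeze_zero (fun _ => norm_nonneg _)
      (fun n => hθ n s) (tendsto_pow_atTop_nhds_zero_of_lt_one (by norm_num) (by norm_num)))
  have hlim' : Tendsto (fun n => mixtureTheory (hw N) (hw1 N) (θ n)) atTop
      (𝓝 (mixtureTheory (hw N) (hw1 N) (q N))) := by
    refine tendsto_subtype_rng.2 (tendsto_of_tendsto_finCyl fun n σ => ?_)
    simp only [mixtureTheory, ProbabilityMeasure.coe_mk, mixture_real (hw _), real_finCyl_iid]
    refine tendsto_finsetSum _ fun s _ => tendsto_const_nhds.mul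
      (tendsto_finsetProd _ fun j _ => ?_)
    split_ifs
    · exact hθlim s
    · exact (hθlim s).const_sub 1
  refine mem_closure_of_tendsto hlim' ?_
  have hr' : Tendsto (fun n => 1 - 16 * (8⁻¹ : ℝ) ^ n) atTop (𝓝 1) := by
    simpa using ((tendsto_pow_atTop_nhds_zero_of_lt_one (r := (8⁻¹ : ℝ)) (by norm_num)
      (by norm_num)).const_mul 16).const_sub 1
  have hL : ∀ᶠ n in atTop, ∀ s : Fin (N + 1) → Bool, L (wordFreq s) ≤ n :=
    eventually_all.2 fun s => eventually_ge_atTop _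
  filter_upwards [hL, hr'.eventually (lt_mem_nhds hr)] with n hn hrn
  refine hrn.trans_le ?_
  simp only [mixtureTheory, ProbabilityMeasure.coe_mk, mixture_real (hw _)]
  rw [← one_mul (1 - 16 * (8⁻¹ : ℝ) ^ n), ← congrArg (· * (1 - 16 * (8⁻¹ : ℝ) ^ n)) (hw1 N),
    Finset.sum_mul]
  refine Finset.sum_le_sum fun s _ => mul_le_mul_of_nonneg_left ?_ (hw N s)
  exact (hvis n s _ (hn s)).trans (measureReal_mono (Set.subset_iUnion (fun q => visits q (L q)) _))

lemma lowerSemicontinuous_measure_of_isOpen {G : Set Omega} (hG : IsOpen G) :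
    LowerSemicontinuous fun μ : ExchangeableTheory => (μ.1 : Measure Omega) G :=
  lowerSemicontinuous_iff_le_liminf.2 fun _ =>
    ProbabilityMeasure.le_liminf_measure_open_of_tendsto
      (continuous_subtype_val.tendsto _) hG

lemma measurable_measure_of_isOpen {G : Set Omega} (hG : IsOpen G) :
    Measurable fun μ : ExchangeableTheory => (μ.1 : Measure Omega) G := by
  have : BorelSpace (ProbabilityMeasure Omega) := ⟨rfl⟩
  exact (lowerSemicontinuous_measure_of_isOpen hG).measurable

/-- Generic theories assign probability one to the union of the visits around all rationals. -/
lemma residual_measure_visits_eq_one (L : ℚ → ℕ) :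
    {μ : ExchangeableTheory | (μ.1 : Measure Omega) (⋃ q, visits q (L q)) = 1} ∈
      residual ExchangeableTheory := by
  have hopen : IsOpen (⋃ q, visits q (L q)) := isOpen_iUnion fun q => isOpen_visits _ _
  have h : ∀ m : ℕ, ∀ᶠ μ : ExchangeableTheory in residual ExchangeableTheory,
      1 - 1 / ((m : ℝ) + 1) < (μ.1 : Measure Omega).real (⋃ q, visits q (L q)) := by
    intro m
    have h0 : 0 ≤ 1 - 1 / ((m : ℝ) + 1) := by
      rw [sub_nonneg, div_le_one (by positivity)]
      simp
    have h1 : 1 - 1 / ((m : ℝ) + 1) < 1 := by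
      have : 0 < 1 / ((m : ℝ) + 1) := by positivity
      linarith
    refine residual_of_dense_open ?_ (dense_visits L h1)
    have := (lowerSemicontinuous_measure_of_isOpen hopen).isOpen_preimage
      (ENNReal.ofReal (1 - 1 / ((m : ℝ) + 1)))
    convert this using 1
    ext μ
    exact (ENNReal.ofReal_lt_iff_lt_toReal h0 (measure_ne_top _ _)).symm
  filter_upwards [eventually_countable_forall.2 h] with μ hμ
  have : (1 : ℝ) ≤ (μ.1 : Measure Omega).real (⋃ q, visits q (L q)) := by
    refine le_of_tendsto (f := fun m : ℕ => 1 - 1 / ((m : ℝ) + 1)) (x := atTop) ?_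
      (Eventually.of_forall fun m => (hμ m).le)
    simpa using (tendsto_one_div_add_atTop_nhds_zero_nat (𝕜 := ℝ)).const_sub 1
  refine le_antisymm prob_le_one ?_
  rw [← ofReal_measureReal, ← ENNReal.ofReal_one]
  exact ENNReal.ofReal_le_ofReal this

/-! ### The test -/

/-- The realizations avoiding `visits q l` whenever this event has probability less than `ε q`. -/
def avoids (ε : ℚ → ℝ≥0∞) (μ : Measure Omega) : Set Omega :=
  {x | ∀ q l, μ (visits q l) < ε q → x ∉ visits q l}

lemma measure_compl_avoids_le (ε : ℚ → ℝ≥0∞) (μ : Measure Omega) :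
    μ (avoids ε μ)ᶜ ≤ ∑' q, ε q := by
  classical
  have hsub : (avoids ε μ)ᶜ ⊆
      ⋃ q, ⋃ (l : ℕ) (_ : μ (visits q l) < ε q), visits q l := by
    intro x hx
    simpa [avoids] using hx
  refine (measure_mono hsub).trans ((measure_iUnion_le _).trans (ENNReal.tsum_le_tsum fun q => ?_))
  by_cases h : ∃ l, μ (visits q l) < ε q
  · refine (measure_mono (t := visits q (Nat.find h)) ?_).trans (Nat.find_spec h).le
    exact Set.iUnion₂_subset fun l hl => visits_antitone q (Nat.find_min' h hl)
  · push Not at h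
    simp [fun l => not_lt.2 (h l)]

/-- Almost every realization has only prefixes of positive probability. -/
lemma ae_pos_cyl_pref (μ : Measure Omega) : ∀ᵐ x ∂μ, ∀ n, 0 < μ (cyl (pref x n)) := by
  refine ae_all_iff.2 fun n => ?_
  have : {x | ¬ 0 < μ (cyl (pref x n))} ⊆
      ⋃ (s : Fin n → Bool) (_ : μ (finCyl s) = 0), finCyl s := by
    intro x hx
    simp only [Set.mem_ofPred_eq, not_lt, nonpos_iff_eq_zero, cyl_pref] at hx
    exact Set.mem_iUnion₂.2 ⟨initSeg n x, hx, mem_finCyl.2 rfl⟩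
  refine measure_mono_null this (measure_iUnion_null fun s => measure_iUnion_null fun h => h)

/-- A realization of a generic theory almost surely fails `avoids` for a theory drawn at random
from any given distribution. -/
lemma residual_prod_avoids_eq_zero (ζ : Measure ExchangeableTheory) [IsProbabilityMeasure ζ]
    {ε : ℚ → ℝ≥0∞} (hε : ∀ q, 0 < ε q) :
    {μ : ExchangeableTheory | (ζ.prod (μ.1 : Measure Omega))
      {p | p.2 ∈ avoids ε (p.1.1 : Measure Omega)} = 0} ∈ residual ExchangeableTheory := by
  let B : ℚ → ℕ → Set ExchangeableTheory := fun q l =>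
    {ν | ε q ≤ (ν.1 : Measure Omega) (visits q l)}
  have hBm : ∀ q l, MeasurableSet (B q l) := fun q l =>
    measurableSet_le measurable_const (measurable_measure_of_isOpen (isOpen_visits q l))
  have hB : ∀ q, Tendsto (fun l => ζ (B q l)) atTop (𝓝 0) := by
    intro q
    have hempty : ⋂ l, B q l = ∅ := by
      refine Set.eq_empty_of_forall_notMem fun ν hν => ?_
      obtain ⟨l, hl⟩ := ((tendsto_measure_visits ν.2 q).eventually (gt_mem_nhds (hε q))).exists
      exact absurd (Set.mem_iInter.1 hν l) (not_le.2 hl)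
    rw [← measure_empty (μ := ζ), ← hempty]
    refine tendsto_measure_iInter_atTop (fun l => (hBm q l).nullMeasurableSet) ?_
      ⟨0, measure_ne_top _ _⟩
    exact fun l l' h ν hν => le_trans hν (measure_mono (visits_antitone q h))
  have hL : ∀ (m : ℕ) q, ∃ l, ζ (B q l) < ((m : ℝ≥0∞) + 1)⁻¹ := fun m q =>
    ((hB q).eventually (gt_mem_nhds (by simp))).exists
  choose L hL using hL
  have hV : MeasurableSet
      {p : ExchangeableTheory × Omega | p.2 ∈ avoids ε (p.1.1 : Measure Omega)} := by
    have : {p : ExchangeableTheory × Omega | p.2 ∈ avoids ε (p.1.1 : Measure Omega)} =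
        ⋂ q, ⋂ l, (Prod.fst ⁻¹' B q l ∪ Prod.snd ⁻¹' (visits q l)ᶜ) := by
      ext p
      simp only [avoids, B, Set.mem_ofPred_eq, Set.mem_iInter, Set.mem_union, Set.mem_preimage,
        Set.mem_compl_iff]
      refine forall₂_congr fun q l => ?_
      rw [← not_lt]
      tauto
    rw [this]
    exact MeasurableSet.iInter fun q => MeasurableSet.iInter fun l =>
      (measurable_fst (hBm q l)).union (measurable_snd (isOpen_visits q l).measurableSet.compl)
  have hres : ∀ᶠ μ : ExchangeableTheory in residual ExchangeableTheory,
      ∀ m : ℕ, (μ.1 : Measure Omega) (⋃ q, visits q (L m q)) = 1 :=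
    eventually_countable_forall.2 fun m => residual_measure_visits_eq_one (L m)
  filter_upwards [hres] with μ hμ
  have hae : ∀ᵐ x ∂(μ.1 : Measure Omega), ∀ m : ℕ, x ∈ ⋃ q, visits q (L m q) :=
    ae_all_iff.2 fun m => (prob_compl_eq_zero_iff
      (isOpen_iUnion fun q => isOpen_visits _ _).measurableSet).2 (hμ m)
  rw [Measure.prod_apply_symm hV, lintegral_eq_zero_iff (measurable_measure_prodMk_right hV)]
  filter_upwards [hae] with x hx
  refine le_antisymm (le_of_tendsto_of_tendsto' tendsto_const_nhds
    ENNReal.tendsto_inv_nat_nhds_zero fun m => ?_) zero_le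
  obtain ⟨q, hq⟩ := Set.mem_iUnion.1 (hx m)
  refine le_trans (measure_mono fun ν hν => ?_)
    ((hL m q).le.trans (ENNReal.inv_le_inv.2 le_self_add))
  by_contra hlt
  exact hν q _ (not_le.1 hlt) hq

/-- There is a measurable test whose acceptance sets are, up to histories of probability zero, the
unions of the sets `avoids (ε k) μ`. -/
lemma exists_test_avoids (ε : ℕ → ℚ → ℝ≥0∞) :
    ∃ T : (ℕ → ℝ × Bool) → Bool, Measurable T ∧
      ∀ μ : Measure Omega, IsProbabilityMeasure μ → Exchangeable μ →
        acceptSet T μ = {x | (∀ n, 0 < μ (cyl (pref x n))) ∧ ∃ k, x ∈ avoids (ε k) μ} := by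
  classical
  choose c hcm hc using fun q l => readable_measure (isOpen_visits q l).measurableSet
  have hout : Measurable fun (d : ℕ → ℝ × Bool) n => (d n).2 := by fun_prop
  let A : Set (ℕ → ℝ × Bool) :=
    ⋃ k, ⋂ q, ⋂ l, ({d | ε k q ≤ c q l d} ∪ (fun d n => (d n).2) ⁻¹' (visits q l)ᶜ)
  have hA : MeasurableSet A := MeasurableSet.iUnion fun k => MeasurableSet.iInter fun q =>
    MeasurableSet.iInter fun l => (measurableSet_le measurable_const (hcm q l)).union
      (hout (isOpen_visits q l).measurableSet.compl)
  refine ⟨fun d => decide (d ∈ A), measurable_to_bool (by simpa [Set.preimage] using hA),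
    fun μ hμ he => ?_⟩
  ext x
  refine and_congr_right fun hpos => ?_
  have hread := fun q l => hc q l μ hμ he x trivial hpos
  change decide (testInput μ x ∈ A) = true ↔ _
  simp only [decide_eq_true_eq, A, avoids, Set.mem_iUnion, Set.mem_iInter, Set.mem_union,
    Set.mem_ofPred_eq, Set.mem_preimage, Set.mem_compl_iff, hread]
  refine exists_congr fun k => forall₂_congr fun q l => ?_
  rw [← not_lt]
  exact Decidable.imp_iff_not_or.symm

end ExchangeableTest


/-- Theorem 1: there is a prequential test T that accepts every exchangeable data generating
process with probability 1 and is strongly non-manipulable w.r.t. the paradigm of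
exchangeable theories. -/
theorem exists_prequential_test_for_exchangeable :
    ∃ T : (ℕ → ℝ × Bool) → Bool, Measurable T ∧
      (∀ μ : ProbabilityMeasure Omega, Exchangeable (μ : Measure Omega) →
        (μ : Measure Omega) (acceptSet T (μ : Measure Omega)) = 1) ∧
      (∀ ζ : Measure {μ : ProbabilityMeasure Omega // Exchangeable (μ : Measure Omega)},
        IsProbabilityMeasure ζ →
        {μ : {μ : ProbabilityMeasure Omega // Exchangeable (μ : Measure Omega)} |
            (ζ.prod (μ.1 : Measure Omega))
              {p : {μ : ProbabilityMeasure Omega // Exchangeable (μ : Measure Omega)} × Omega |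
                p.2 ∈ acceptSet T (p.1.1 : Measure Omega)} = 0}
          ∈ residual {μ : ProbabilityMeasure Omega // Exchangeable (μ : Measure Omega)}) := by
  choose ε hε hεsum using fun k : ℕ =>
    ENNReal.exists_pos_sum_of_countable (ε := ((k : ENNReal) + 1)⁻¹) (by simp) ℚ
  obtain ⟨T, hT, hacc⟩ := ExchangeableTest.exists_test_avoids fun k q => (ε k q : ENNReal)
  refine ⟨T, hT, fun μ he => ?_, fun ζ _ => ?_⟩
  · rw [hacc μ inferInstance he]
    have hae : ∀ᵐ x ∂(μ : Measure Omega), ∃ k,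
        x ∈ ExchangeableTest.avoids (fun q => (ε k q : ENNReal)) μ := by
      refine le_antisymm (le_of_tendsto_of_tendsto' tendsto_const_nhds
        ENNReal.tendsto_inv_nat_nhds_zero fun k => ?_) zero_le
      refine (measure_mono ?_).trans ((ExchangeableTest.measure_compl_avoids_le _ μ).trans
        ((hεsum k).le.trans (ENNReal.inv_le_inv.2 le_self_add)))
      exact fun x hx hk => hx ⟨k, hk⟩
    rw [measure_congr (eventuallyEq_univ.2 ((ExchangeableTest.ae_pos_cyl_pref μ).and hae)),
      measure_univ]
  · have hres : ∀ᶠ μ in residual ExchangeableTest.ExchangeableTheory, ∀ k,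
        (ζ.prod (μ.1 : Measure Omega)) {p | p.2 ∈
          ExchangeableTest.avoids (fun q => (ε k q : ENNReal)) (p.1.1 : Measure Omega)} = 0 :=
      eventually_countable_forall.2 fun k =>
        ExchangeableTest.residual_prod_avoids_eq_zero ζ fun q => by exact_mod_cast hε k q
    filter_upwards [hres] with μ hμ
    refine measure_mono_null ?_ (measure_iUnion_null hμ)
    intro p hp
    rw [Set.mem_ofPred_eq, hacc _ inferInstance p.1.2] at hp
    exact Set.mem_iUnion.2 hp.2
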